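/- There exist absolute constants ε₀ > 0 and C > 0 such that for every (1+ε)-quasigeodesic γ : ℝ → ℍ with ε < ε₀ and γ(0) = O, writing γ(s) = (ζ(s);τ(s)) with ζ(s) ∈ ℂ and τ(s) ∈ ℝ, one has 1 − C√ε ≤ |ζ(s)|/|s| ≤ 1 + Cε for all s ≠ 0, and |τ(s)| ≤ C ε^{1/4} s² for all s ∈ ℝ. -/

import Mathlib

noncomputable section

open MeasureTheory

/-- Points of the Heisenberg group `ℍ`, identified with `ℝ³ ≅ ℂ × ℝ`:
`(x, y, t)` corresponds to `(z ; t)` with `z = x + iy`. -/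
abbrev H : Type := ℝ × ℝ × ℝ

/-- The Heisenberg group law
`(x,y,t)·(x',y',t') = (x+x', y+y', t+t'+2(x'y − xy'))`. -/
def Hmul (p q : H) : H :=
  (p.1 + q.1, p.2.1 + q.2.1, p.2.2 + q.2.2 + 2 * (q.1 * p.2.1 - p.1 * q.2.1))

/-- The Heisenberg group inverse. -/
def Hinv (p : H) : H := (-p.1, -p.2.1, -p.2.2)

/-- The identity `O = (0,0,0)`. -/
def HO : H := (0, 0, 0)

/-- The control (Carnot–Carathéodory) distance: the infimum of the lengths
`∫₀¹ √(a(s)² + b(s)²) ds` of horizontal Lipschitz curves `γ` joining `P` to `Q`,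
i.e. curves satisfying a.e. `γ' = a·X(γ) + b·Y(γ)` where `X = ∂ₓ + 2y∂_t` and
`Y = ∂_y − 2x∂_t`. -/
def dH (P Q : H) : ℝ :=
  sInf { L : ℝ | ∃ (γ : ℝ → H) (a b : ℝ → ℝ) (K : NNReal),
    LipschitzWith K γ ∧ γ 0 = P ∧ γ 1 = Q ∧
    (∀ᵐ s ∂volume, s ∈ Set.Icc (0:ℝ) 1 →
      HasDerivAt γ (a s, b s, 2 * (γ s).2.1 * a s - 2 * (γ s).1 * b s) s) ∧
    IntervalIntegrable (fun s => Real.sqrt (a s ^ 2 + b s ^ 2)) volume 0 1 ∧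
    L = ∫ s in (0:ℝ)..1, Real.sqrt (a s ^ 2 + b s ^ 2) }

/-- `γ : ℝ → ℍ` is a `(1+ε)`-quasigeodesic. -/
def IsQuasiGeodesic (ε : ℝ) (γ : ℝ → H) : Prop :=
  ∀ s s' : ℝ, (1 + ε)⁻¹ * |s - s'| ≤ dH (γ s) (γ s') ∧
    dH (γ s) (γ s') ≤ (1 + ε) * |s - s'|

/-- `f : ℍ → ℍ` is `(1+ε)`-biLipschitz for the control distance. -/
def IsBiLip (ε : ℝ) (f : H → H) : Prop :=
  ∀ P Q : H, (1 + ε)⁻¹ * dH P Q ≤ dH (f P) (f Q) ∧ dH (f P) (f Q) ≤ (1 + ε) * dH P Q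

/-- `(a,b)` is the horizontal speed of `γ`: a.e. `γ'(s) = a(s)X(γ(s)) + b(s)Y(γ(s))`. -/
def HasHorizSpeed (γ : ℝ → H) (a b : ℝ → ℝ) : Prop :=
  ∀ᵐ s ∂volume, HasDerivAt γ (a s, b s, 2 * (γ s).2.1 * a s - 2 * (γ s).1 * b s) s


def IsPath (P Q : H) (L : ℝ) : Prop :=
  ∃ (γ : ℝ → H) (a b : ℝ → ℝ) (K : NNReal),
    LipschitzWith K γ ∧ γ 0 = P ∧ γ 1 = Q ∧
    (∀ᵐ s ∂volume, s ∈ Set.Icc (0:ℝ) 1 →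
      HasDerivAt γ (a s, b s, 2 * (γ s).2.1 * a s - 2 * (γ s).1 * b s) s) ∧
    IntervalIntegrable (fun s => Real.sqrt (a s ^ 2 + b s ^ 2)) volume 0 1 ∧
    L = ∫ s in (0:ℝ)..1, Real.sqrt (a s ^ 2 + b s ^ 2)

lemma dH_eq (P Q : H) : dH P Q = sInf {L | IsPath P Q L} := rfl

lemma IsPath.nonneg {P Q : H} {L : ℝ} (h : IsPath P Q L) : 0 ≤ L := by
  obtain ⟨γ, a, b, K, h1, h2, h3, h4, h5, rfl⟩ := h
  exact intervalIntegral.integral_nonneg (by norm_num) (fun s _ => Real.sqrt_nonneg _)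

lemma bddBelow_path (P Q : H) : BddBelow {L | IsPath P Q L} := ⟨0, fun _ h => h.nonneg⟩

lemma dH_le {P Q : H} {L : ℝ} (h : IsPath P Q L) : dH P Q ≤ L := by
  rw [dH_eq]; exact csInf_le (bddBelow_path P Q) h

lemma IsPath.seg (P : H) (u v : ℝ) : IsPath P (Hmul P (u, v, 0)) (Real.sqrt (u^2+v^2)) := by
  refine ⟨fun s => P + s • ((u, v, 2 * (u * P.2.1 - P.1 * v)) : H), fun _ => u, fun _ => v,
    ‖((u, v, 2 * (u * P.2.1 - P.1 * v)) : H)‖₊, ?_, ?_, ?_, ?_, ?_, ?_⟩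
  · apply LipschitzWith.of_dist_le_mul
    intro x y
    rw [dist_add_left, dist_eq_norm, ← sub_smul, norm_smul, dist_eq_norm, mul_comm]
    rfl
  · simp
  · ext <;> simp [Hmul]
  · refine Filter.Eventually.of_forall fun s _ => ?_
    have := ((hasDerivAt_id s).smul_const ((u, v, 2 * (u * P.2.1 - P.1 * v)) : H)).const_add P
    refine this.congr_deriv ?_
    ext <;> simp
    ring
  · exact intervalIntegrable_const
  · simp

lemma IsPath.clm {P Q : H} {L : ℝ} (h : IsPath P Q L) (Λ : H →L[ℝ] H) (R : H) 
    (A B : ℝ → ℝ → ℝ)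
    (hΛ : ∀ x y t a b, Λ (a, b, 2 * y * a - 2 * x * b) =
      (A a b, B a b, 2 * (R + Λ (x, y, t)).2.1 * A a b - 2 * (R + Λ (x, y, t)).1 * B a b))
    (hn : ∀ a b, A a b ^2 + B a b ^2 = a^2+b^2) :
    IsPath (R + Λ P) (R + Λ Q) L := by
  obtain ⟨γ, a, b, K, h1, rfl, rfl, h4, h5, rfl⟩ := h
  refine ⟨fun s => R + Λ (γ s), fun s => A (a s) (b s), fun s => B (a s) (b s), ‖Λ‖₊ * K, 
    ?_, rfl, rfl, ?_, ?_, ?_⟩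
  · have := Λ.lipschitz.comp h1
    apply LipschitzWith.of_dist_le_mul
    intro x y
    rw [dist_add_left]
    exact this.dist_le_mul x y
  · filter_upwards [h4] with s hs hs'
    have := (Λ.hasFDerivAt.comp_hasDerivAt s (hs hs')).const_add R
    rw [hΛ (γ s).1 (γ s).2.1 (γ s).2.2] at this
    exact this
  · simpa only [hn] using h5
  · simp only [hn]

lemma IsPath.left {P Q : H} {L : ℝ} (h : IsPath P Q L) (R : H) :
    IsPath (Hmul R P) (Hmul R Q) L := by
  let l : H →ₗ[ℝ] H := 
    { toFun := fun p => (p.1, p.2.1, p.2.2 + 2 * (p.1 * R.2.1 - R.1 * p.2.1))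
      map_add' := by intro x y; ext <;> simp; ring
      map_smul' := by intro c x; ext <;> simp; ring }
  have := h.clm (LinearMap.toContinuousLinearMap l) R (fun a _ => a) (fun _ b => b)
    (by intro x y t a b; ext <;> simp [l]; ring) (by intros; rfl)
  convert this using 1
  · ext <;> simp [l, Hmul]; ring
  · ext <;> simp [l, Hmul]; ring

lemma ae_comp_two {p : ℝ → Prop} (h : ∀ᵐ s, p s) : ∀ᵐ s : ℝ, p (2 * s) := by
  rw [ae_iff] at h ⊢
  have := Real.volume_preimage_mul_left (a := 2) (by norm_num) {a | ¬ p a}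
  rw [h, mul_zero] at this
  exact this

lemma IsPath.trans {P Q R : H} {L M : ℝ} (h : IsPath P Q L) (h' : IsPath Q R M) :
    IsPath P R (L + M) := by
  obtain ⟨γ, a, b, K, h1, rfl, rfl, h4, h5, rfl⟩ := h
  obtain ⟨γ', a', b', K', h1', h2', rfl, h4', h5', rfl⟩ := h'
  set F : ℝ → ℝ := fun s => if s ≤ 1/2 then 2 * Real.sqrt (a (2*s) ^ 2 + b (2*s) ^ 2) else 
    2 * Real.sqrt (a' (2*s-1) ^ 2 + b' (2*s-1) ^ 2) with hF
  have e : (fun s : ℝ => Real.sqrt ((if s ≤ 1/2 then 2 * a (2*s) else 2 * a' (2*s-1))^2 + 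
     (if s ≤ 1/2 then 2 * b (2*s) else 2 * b' (2*s-1))^2)) = F := by
    funext s
    simp only [hF]
    split_ifs
    · rw [show (2 * a (2*s))^2 + (2*b (2*s))^2 = 2^2 * (a (2*s) ^ 2 + b (2*s) ^ 2) by ring,
        Real.sqrt_mul (by norm_num), Real.sqrt_sq (by norm_num)]
    · rw [show (2 * a' (2*s-1))^2 + (2*b' (2*s-1))^2 = 2^2 * (a' (2*s-1) ^ 2 + b' (2*s-1) ^ 2) by ring,
        Real.sqrt_mul (by norm_num), Real.sqrt_sq (by norm_num)]
  have eL : Set.EqOn (fun s => 2 * Real.sqrt (a (2*s) ^ 2 + b (2*s) ^ 2)) F (Set.uIoc 0 (1/2)) := by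
    intro s hs
    rw [Set.uIoc_of_le (by norm_num)] at hs
    simp only [hF]; rw [if_pos hs.2]
  have eR : Set.EqOn (fun s => 2 * Real.sqrt (a' (2*s-1) ^ 2 + b' (2*s-1) ^ 2)) F (Set.uIoc (1/2) 1) := by
    intro s hs
    rw [Set.uIoc_of_le (by norm_num)] at hs
    simp only [hF]; rw [if_neg (not_le.2 hs.1)]
  have iL0 : IntervalIntegrable (fun s => 2 * Real.sqrt (a (2*s) ^ 2 + b (2*s) ^ 2)) volume 0 (1/2) := by
    have := (h5.comp_mul_left (c := 2)).const_mul 2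
    simpa using this
  have iR0 : IntervalIntegrable (fun s => 2 * Real.sqrt (a' (2*s-1) ^ 2 + b' (2*s-1) ^ 2)) volume (1/2) 1 := by
    have := ((h5'.comp_sub_right 1).comp_mul_left (c := 2)).const_mul 2
    norm_num at this
    simpa using this
  have iL : IntervalIntegrable F volume 0 (1/2) := iL0.congr eL
  have iR : IntervalIntegrable F volume (1/2) 1 := iR0.congr eR
  refine ⟨fun s => γ (min (2*s) 1) + γ' (max (2*s-1) 0) - γ 1, 
    fun s => if s ≤ 1/2 then 2 * a (2*s) else 2 * a' (2*s-1), 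
    fun s => if s ≤ 1/2 then 2 * b (2*s) else 2 * b' (2*s-1), K * 2 + K' * 2, ?_, ?_, ?_, ?_, ?_, ?_⟩
  · have g1 : LipschitzWith 2 (fun s : ℝ => 2 * s) := by
      apply LipschitzWith.of_dist_le_mul
      intro x y
      rw [Real.dist_eq, Real.dist_eq, ← mul_sub, abs_mul]; simp
    have g1' : LipschitzWith 2 (fun s : ℝ => 2 * s - 1) := by
      apply LipschitzWith.of_dist_le_mul
      intro x y
      rw [Real.dist_eq, Real.dist_eq, show 2 * x - 1 - (2 * y - 1) = 2 * (x-y) by ring, abs_mul]; simp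
    have g2 := h1.comp (g1.min_const 1)
    have g3 := h1'.comp (g1'.max_const 0)
    have := g2.add g3
    apply LipschitzWith.of_dist_le_mul
    intro x y
    rw [dist_sub_right]
    exact this.dist_le_mul x y
  · simp [h2']
  · norm_num [h2']
  · have hne : ∀ᵐ s : ℝ, s ≠ 1/2 := by
      rw [ae_iff]; simp
    have k1 := ae_comp_two h4
    have k2 := ae_comp_two ((measurePreserving_sub_right volume (1:ℝ)).quasiMeasurePreserving.ae h4')
    filter_upwards [hne, k1, k2] with s hs q1 q2 hs'
    rcases lt_or_gt_of_ne hs with hlt | hgt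
    · have e1 : min (2*s) 1 = 2*s := min_eq_left (by linarith)
      have e2 : max (2*s-1) 0 = 0 := max_eq_right (by linarith)
      simp only [if_pos hlt.le, e1, e2, h2', add_sub_cancel_right]
      have q := (q1 ⟨by linarith [hs'.1], by linarith⟩).scomp s ((hasDerivAt_id s).const_mul 2)
      have q' := q.congr_of_eventuallyEq (f₁ := fun s => γ (min (2*s) 1) + γ' (max (2*s-1) 0) - γ 1) (by
        filter_upwards [Iio_mem_nhds hlt] with r hr
        have hr : r < 1/2 := hr
        have e1 : min (2*r) 1 = 2*r := min_eq_left (by linarith)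
        have e2 : max (2*r-1) 0 = 0 := max_eq_right (by linarith)
        simp [e1, e2, h2'])
      refine q'.congr_deriv ?_
      ext <;> simp
      ring
    · have e1 : min (2*s) 1 = 1 := min_eq_right (by linarith)
      have e2 : max (2*s-1) 0 = 2*s-1 := max_eq_left (by linarith)
      simp only [if_neg (not_le.2 hgt), e1, e2, add_sub_cancel_left]
      have q := (q2 ⟨by linarith, by linarith [hs'.2]⟩).scomp s (((hasDerivAt_id s).const_mul 2).sub_const 1)
      have q' := q.congr_of_eventuallyEq (f₁ := fun s => γ (min (2*s) 1) + γ' (max (2*s-1) 0) - γ 1) (by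
        filter_upwards [Ioi_mem_nhds hgt] with r hr
        have hr : 1/2 < r := hr
        have e1 : min (2*r) 1 = 1 := min_eq_right (by linarith)
        have e2 : max (2*r-1) 0 = 2*r-1 := max_eq_left (by linarith)
        simp [e1, e2, h2'])
      refine q'.congr_deriv ?_
      ext <;> simp
      ring
  · rw [e]; exact iL.trans iR
  · rw [e, ← intervalIntegral.integral_add_adjacent_intervals iL iR]
    congr 1
    · rw [← intervalIntegral.integral_congr_ae (Filter.Eventually.of_forall fun s hs => eL hs)]
      rw [intervalIntegral.integral_const_mul]
      have := intervalIntegral.integral_comp_mul_left (a := 0) (b := 1/2) (fun s => Real.sqrt (a s ^ 2 + b s ^ 2)) (c := 2) (by norm_num)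
      rw [this]; norm_num
      try ring
    · rw [← intervalIntegral.integral_congr_ae (Filter.Eventually.of_forall fun s hs => eR hs)]
      rw [intervalIntegral.integral_const_mul]
      have := intervalIntegral.integral_comp_mul_sub (a := 1/2) (b := 1) (fun s => Real.sqrt (a' s ^ 2 + b' s ^ 2)) (c := 2) (by norm_num) 1
      rw [this]; norm_num
      try ring

lemma lip_ftc {f g : ℝ → ℝ} {K : NNReal} (hf : LipschitzWith K f)
    (h : ∀ᵐ s ∂volume, s ∈ Set.Icc (0:ℝ) 1 → HasDerivAt f (g s) s) :
    IntervalIntegrable g volume 0 1 ∧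
      ∀ r ∈ Set.Icc (0:ℝ) 1, ∫ s in (0:ℝ)..r, g s = f r - f 0 := by
  constructor
  · have h1 := (hf.lipschitzOnWith (s := Set.uIcc 0 1)).absolutelyContinuousOnInterval.intervalIntegrable_deriv
    refine h1.congr_ae ?_
    rw [Filter.EventuallyEq, ae_restrict_iff' measurableSet_uIoc]
    filter_upwards [h] with s hs hs'
    rw [Set.uIoc_of_le (by norm_num)] at hs'
    exact (hs ⟨hs'.1.le, hs'.2⟩).deriv
  · intro r hr
    rw [← (hf.lipschitzOnWith (s := Set.uIcc 0 r)).absolutelyContinuousOnInterval.integral_deriv_eq_sub]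
    apply intervalIntegral.integral_congr_ae
    filter_upwards [h] with s hs hs'
    rw [Set.uIoc_of_le hr.1] at hs'
    exact (hs ⟨hs'.1.le, hs'.2.trans hr.2⟩).deriv.symm

lemma abs_le_int {f g : ℝ → ℝ} (hg : IntervalIntegrable g volume 0 1) (h0 : f 0 = 0)
    (h : ∀ r ∈ Set.Icc (0:ℝ) 1, ∫ s in (0:ℝ)..r, g s = f r - f 0) :
    ∀ r ∈ Set.Icc (0:ℝ) 1, |f r| ≤ ∫ s in (0:ℝ)..1, |g s| := by
  intro r hr
  have := h r hr
  rw [h0, sub_zero] at this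
  rw [← this]
  refine (intervalIntegral.abs_integral_le_integral_abs hr.1).trans ?_
  exact intervalIntegral.integral_mono_interval le_rfl hr.1 hr.2
    (Filter.Eventually.of_forall fun s => abs_nonneg _) hg.abs

lemma mink {p q : ℝ → ℝ} (hp : IntervalIntegrable p volume 0 1)
    (hq : IntervalIntegrable q volume 0 1)
    (hc : IntervalIntegrable (fun s => Real.sqrt (p s ^2 + q s ^2)) volume 0 1) :
    (∫ s in (0:ℝ)..1, |p s|)^2 + (∫ s in (0:ℝ)..1, |q s|)^2 ≤
      (∫ s in (0:ℝ)..1, Real.sqrt (p s ^2 + q s ^2))^2 := by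
  set P := ∫ s in (0:ℝ)..1, |p s|
  set Q := ∫ s in (0:ℝ)..1, |q s|
  set L := ∫ s in (0:ℝ)..1, Real.sqrt (p s ^2 + q s ^2)
  set R := Real.sqrt (P^2+Q^2)
  have hR : R^2 = P^2+Q^2 := Real.sq_sqrt (by positivity)
  have hR0 : 0 ≤ R := Real.sqrt_nonneg _
  have key : P * P + Q * Q ≤ R * L := by
    have e1 : P * P + Q * Q = ∫ s in (0:ℝ)..1, (P * |p s| + Q * |q s|) := by
      rw [intervalIntegral.integral_add (hp.abs.const_mul P) (hq.abs.const_mul Q),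
        intervalIntegral.integral_const_mul, intervalIntegral.integral_const_mul]
    have e2 : R * L = ∫ s in (0:ℝ)..1, R * Real.sqrt (p s ^2 + q s ^2) := by
      rw [intervalIntegral.integral_const_mul]
    rw [e1, e2]
    apply intervalIntegral.integral_mono (by norm_num)
      ((hp.abs.const_mul P).add (hq.abs.const_mul Q)) (hc.const_mul R)
    intro s
    change P * |p s| + Q * |q s| ≤ R * Real.sqrt (p s ^2 + q s ^2)
    rw [← Real.sqrt_mul (by positivity)]
    apply Real.le_sqrt_of_sq_le
    rw [← sq_abs (p s), ← sq_abs (q s)]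
    nlinarith [sq_nonneg (P * |q s| - Q * |p s|)]
  have hL : 0 ≤ L := intervalIntegral.integral_nonneg (by norm_num) (fun s _ => Real.sqrt_nonneg _)
  have h2 : R * R ≤ R * L := by nlinarith
  rcases hR0.eq_or_lt with h | h
  · rw [← hR, ← h]; nlinarith
  · have := le_of_mul_le_mul_left h2 h
    nlinarith

/-- rotated coordinates of a path from the origin -/
lemma IsPath.frame {w1 w2 t L r u1 u2 : ℝ} (h : IsPath HO (w1, w2, t) L) (hu : u1^2+u2^2 = 1)
    (h1 : w1 = r * u1) (h2 : w2 = r * u2) :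
    ∃ (γ : ℝ → H) (K : NNReal) (p q : ℝ → ℝ), LipschitzWith K γ ∧ γ 0 = HO ∧ γ 1 = (w1, w2, t) ∧
      (∀ᵐ s ∂volume, s ∈ Set.Icc (0:ℝ) 1 →
        HasDerivAt γ (p s * u1 - q s * u2, p s * u2 + q s * u1,
          2 * (γ s).2.1 * (p s * u1 - q s * u2) - 2 * (γ s).1 * (p s * u2 + q s * u1)) s) ∧
      IntervalIntegrable p volume 0 1 ∧ IntervalIntegrable q volume 0 1 ∧
      IntervalIntegrable (fun s => Real.sqrt (p s ^2 + q s ^2)) volume 0 1 ∧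
      L = ∫ s in (0:ℝ)..1, Real.sqrt (p s ^2 + q s ^2) ∧
      (∫ s in (0:ℝ)..1, p s) = r ∧
      |t| ≤ 4 * (∫ s in (0:ℝ)..1, |p s|) * (∫ s in (0:ℝ)..1, |q s|) := by
  obtain ⟨γ, a, b, K, g1, g2, g3, g4, g5, rfl⟩ := h
  have Lx : LipschitzWith K (fun s => (γ s).1) := by
    have := LipschitzWith.prod_fst.comp g1
    simp only [one_mul] at this
    exact this
  have Ly : LipschitzWith K (fun s => (γ s).2.1) := by
    have := LipschitzWith.prod_fst.comp (LipschitzWith.prod_snd.comp g1)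
    simp only [one_mul] at this
    exact this
  have Lt : LipschitzWith K (fun s => (γ s).2.2) := by
    have := LipschitzWith.prod_snd.comp (LipschitzWith.prod_snd.comp g1)
    simp only [one_mul] at this
    exact this
  have Dx : ∀ᵐ s ∂volume, s ∈ Set.Icc (0:ℝ) 1 → HasDerivAt (fun s => (γ s).1) (a s) s := by
    filter_upwards [g4] with s hs hs'
    exact (hs hs').fst
  have Dy : ∀ᵐ s ∂volume, s ∈ Set.Icc (0:ℝ) 1 → HasDerivAt (fun s => (γ s).2.1) (b s) s := by
    filter_upwards [g4] with s hs hs'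
    exact (hs hs').snd.fst
  have Dt : ∀ᵐ s ∂volume, s ∈ Set.Icc (0:ℝ) 1 → HasDerivAt (fun s => (γ s).2.2) 
      (2 * (γ s).2.1 * a s - 2 * (γ s).1 * b s) s := by
    filter_upwards [g4] with s hs hs'
    exact (hs hs').snd.snd
  obtain ⟨ia, fa⟩ := lip_ftc Lx Dx
  obtain ⟨ib, fb⟩ := lip_ftc Ly Dy
  obtain ⟨it, ft⟩ := lip_ftc Lt Dt
  have ip : IntervalIntegrable (fun s => a s * u1 + b s * u2) volume 0 1 :=
    (ia.mul_const u1).add (ib.mul_const u2)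
  have iq : IntervalIntegrable (fun s => b s * u1 - a s * u2) volume 0 1 :=
    (ib.mul_const u1).sub (ia.mul_const u2)
  have fp : ∀ r ∈ Set.Icc (0:ℝ) 1, ∫ s in (0:ℝ)..r, (a s * u1 + b s * u2) = 
      ((γ r).1 * u1 + (γ r).2.1 * u2) - ((γ 0).1 * u1 + (γ 0).2.1 * u2) := by
    intro r hr
    have hsub : Set.uIcc 0 r ⊆ Set.uIcc (0:ℝ) 1 := by
      rw [Set.uIcc_of_le hr.1, Set.uIcc_of_le (by norm_num)]; exact Set.Icc_subset_Icc_right hr.2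
    rw [intervalIntegral.integral_add ((ia.mono_set hsub).mul_const u1) ((ib.mono_set hsub).mul_const u2),
      intervalIntegral.integral_mul_const, intervalIntegral.integral_mul_const, fa r hr, fb r hr]
    ring
  have fq : ∀ r ∈ Set.Icc (0:ℝ) 1, ∫ s in (0:ℝ)..r, (b s * u1 - a s * u2) = 
      ((γ r).2.1 * u1 - (γ r).1 * u2) - ((γ 0).2.1 * u1 - (γ 0).1 * u2) := by
    intro r hr
    have hsub : Set.uIcc 0 r ⊆ Set.uIcc (0:ℝ) 1 := by
      rw [Set.uIcc_of_le hr.1, Set.uIcc_of_le (by norm_num)]; exact Set.Icc_subset_Icc_right hr.2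
    rw [intervalIntegral.integral_sub ((ib.mono_set hsub).mul_const u1) ((ia.mono_set hsub).mul_const u2),
      intervalIntegral.integral_mul_const, intervalIntegral.integral_mul_const, fa r hr, fb r hr]
    ring
  have ea : ∀ s, (a s * u1 + b s * u2) * u1 - (b s * u1 - a s * u2) * u2 = a s := by
    intro s; linear_combination (a s) * hu
  have eb : ∀ s, (a s * u1 + b s * u2) * u2 + (b s * u1 - a s * u2) * u1 = b s := by
    intro s; linear_combination (b s) * hu
  have en : ∀ s, (a s * u1 + b s * u2)^2 + (b s * u1 - a s * u2)^2 = a s ^2 + b s ^2 := by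
    intro s; linear_combination (a s ^2 + b s ^2) * hu
  refine ⟨γ, K, fun s => a s * u1 + b s * u2, fun s => b s * u1 - a s * u2, g1, g2, g3, ?_, 
    ip, iq, ?_, ?_, ?_, ?_⟩
  · simpa only [ea, eb] using g4
  · simpa only [en] using g5
  · simp only [en]
  · rw [fp 1 (by simp), g2, g3, h1, h2]
    simp only [HO]
    linear_combination r * hu
  · have bp := abs_le_int (f := fun s => (γ s).1 * u1 + (γ s).2.1 * u2) ip (by simp [g2, HO]) fp
    have bq := abs_le_int (f := fun s => (γ s).2.1 * u1 - (γ s).1 * u2) iq (by simp [g2, HO]) fq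
    have tt := ft 1 (by simp)
    rw [g2, g3] at tt
    simp only [HO, sub_zero] at tt
    set P := ∫ s in (0:ℝ)..1, |a s * u1 + b s * u2|
    set Q := ∫ s in (0:ℝ)..1, |b s * u1 - a s * u2|
    have i2 : IntervalIntegrable (fun s => 2 * Q * |a s * u1 + b s * u2| + 2 * P * |b s * u1 - a s * u2|) volume 0 1 :=
      (ip.abs.const_mul (2*Q)).add (iq.abs.const_mul (2*P))
    have : 4 * P * Q = ∫ s in (0:ℝ)..1, (2 * Q * |a s * u1 + b s * u2| + 2 * P * |b s * u1 - a s * u2|) := by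
      rw [intervalIntegral.integral_add (ip.abs.const_mul (2*Q)) (iq.abs.const_mul (2*P)),
        intervalIntegral.integral_const_mul, intervalIntegral.integral_const_mul]
      ring
    rw [this, ← tt, ← Real.norm_eq_abs]
    apply intervalIntegral.norm_integral_le_of_norm_le (by norm_num) _ i2
    refine Filter.Eventually.of_forall fun s hs => ?_
    have k1 := bp s ⟨hs.1.le, hs.2⟩
    have k2 := bq s ⟨hs.1.le, hs.2⟩
    have e : 2 * (γ s).2.1 * a s - 2 * (γ s).1 * b s = 
      2 * (((γ s).2.1 * u1 - (γ s).1 * u2) * (a s * u1 + b s * u2) - 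
       ((γ s).1 * u1 + (γ s).2.1 * u2) * (b s * u1 - a s * u2)) := by
      linear_combination (-(2 * (γ s).2.1 * a s - 2 * (γ s).1 * b s)) * hu
    rw [e, Real.norm_eq_abs, abs_mul]
    have := abs_sub (((γ s).2.1 * u1 - (γ s).1 * u2) * (a s * u1 + b s * u2))
       (((γ s).1 * u1 + (γ s).2.1 * u2) * (b s * u1 - a s * u2))
    rw [abs_mul, abs_mul] at this
    have m1 := mul_le_mul_of_nonneg_right k2 (abs_nonneg (a s * u1 + b s * u2))
    have m2 := mul_le_mul_of_nonneg_right k1 (abs_nonneg (b s * u1 - a s * u2))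
    rw [abs_two]
    linarith

lemma exists_unit (w1 w2 : ℝ) : ∃ u1 u2 : ℝ, u1^2+u2^2 = 1 ∧ 
    w1 = Real.sqrt (w1^2+w2^2) * u1 ∧ w2 = Real.sqrt (w1^2+w2^2) * u2 := by
  by_cases h : w1^2+w2^2 = 0
  · have h1 : w1 = 0 := by nlinarith [sq_nonneg w1, sq_nonneg w2]
    have h2 : w2 = 0 := by nlinarith [sq_nonneg w1, sq_nonneg w2]
    exact ⟨1, 0, by norm_num, by simp [h1, h2], by simp [h2]⟩
  · have hp : 0 < w1^2+w2^2 := lt_of_le_of_ne (by positivity) (Ne.symm h)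
    have hs := Real.sqrt_pos.2 hp
    have hq := Real.sq_sqrt hp.le
    refine ⟨w1 / Real.sqrt (w1^2+w2^2), w2 / Real.sqrt (w1^2+w2^2), ?_, ?_, ?_⟩
    · rw [div_pow, div_pow, hq]; field_simp
    · field_simp
    · field_simp

lemma IsPath.dido {w1 w2 t L : ℝ} (h : IsPath HO (w1, w2, t) L) :
    Real.sqrt (w1^2+w2^2) ≤ L ∧ t^2 ≤ 16 * L^2 * (L^2 - (w1^2+w2^2)) := by
  have hL := h.nonneg
  obtain ⟨u1, u2, hu, h1, h2⟩ := exists_unit w1 w2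
  obtain ⟨γ, K, p, q, -, -, -, -, ip, iq, ic, hc, hr, ht⟩ := h.frame hu h1 h2
  have hm := mink ip iq ic
  rw [← hc] at hm
  have hP : Real.sqrt (w1^2+w2^2) ≤ ∫ s in (0:ℝ)..1, |p s| := by
    rw [← hr]
    exact (le_abs_self _).trans (intervalIntegral.abs_integral_le_integral_abs (by norm_num))
  have hr2 := Real.sq_sqrt (show 0 ≤ w1^2+w2^2 by positivity)
  have hr0 := Real.sqrt_nonneg (w1^2+w2^2)
  have hQ : 0 ≤ ∫ s in (0:ℝ)..1, |q s| := 
    intervalIntegral.integral_nonneg (by norm_num) (fun s _ => abs_nonneg _)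
  generalize (∫ s in (0:ℝ)..1, |q s|) = Q at *
  generalize (∫ s in (0:ℝ)..1, |p s|) = P at *
  generalize Real.sqrt (w1^2+w2^2) = r at *
  rw [← hr2]
  have hPL : P ≤ L := abs_le_of_sq_le_sq' (by nlinarith) hL |>.2
  refine ⟨hP.trans hPL, ?_⟩
  have hP0 : 0 ≤ P := hr0.trans hP
  have k1 : Q^2 ≤ L^2 - r^2 := by nlinarith
  have k2 : P^2 ≤ L^2 := by nlinarith
  have k3 : t^2 ≤ (4*P*Q)^2 := by
    rw [← sq_abs t]; exact pow_le_pow_left₀ (abs_nonneg t) ht 2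
  have := mul_le_mul k2 k1 (sq_nonneg Q) (sq_nonneg L)
  nlinarith

lemma stretch_pt (p q μ : ℝ) (hμ : 1 ≤ μ) : Real.sqrt (p^2 + (μ*q)^2) ≤
    Real.sqrt (p^2+q^2) + (μ^2-1) * (Real.sqrt (p^2+q^2) - |p|) := by
  have h1 := Real.sq_sqrt (show 0 ≤ p^2+q^2 by positivity)
  have h0 := Real.sqrt_nonneg (p^2+q^2)
  have h2 : |p| ≤ Real.sqrt (p^2+q^2) := Real.abs_le_sqrt (by nlinarith [sq_nonneg q])
  have h3 := sq_abs p
  have h4 := abs_nonneg p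
  generalize Real.sqrt (p^2+q^2) = c at *
  have hμ2 : 0 ≤ μ^2-1 := by nlinarith
  have hk : 0 ≤ (μ^2-1) * (c - |p|) := mul_nonneg hμ2 (by linarith)
  apply Real.sqrt_le_iff.2
  refine ⟨by linarith, ?_⟩
  have : p^2 + (μ*q)^2 = c^2 + ((μ^2-1) * (c - |p|)) * (c + |p|) := by
    have : q^2 = (c-|p|)*(c+|p|) := by nlinarith
    rw [mul_pow, this]; nlinarith
  rw [this]
  nlinarith

lemma IsPath.stretch {w1 w2 t L : ℝ} (h : IsPath HO (w1, w2, t) L) (μ : ℝ) :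
    ∃ L', IsPath HO (w1, w2, μ * t) L' ∧ (|μ| ≤ 1 → L' ≤ L) ∧ 
      (1 ≤ μ → L' ≤ L + (μ^2-1) * (L - Real.sqrt (w1^2+w2^2))) := by
  obtain ⟨u1, u2, hu, h1, h2⟩ := exists_unit w1 w2
  obtain ⟨γ, K, p, q, g1, g2, g3, g4, ip, iq, ic, hc, hr, -⟩ := h.frame hu h1 h2
  let l : H →ₗ[ℝ] H := 
    { toFun := fun z => ((z.1*u1+z.2.1*u2) * u1 - μ * (z.2.1*u1 - z.1*u2) * u2, 
        (z.1*u1+z.2.1*u2) * u2 + μ * (z.2.1*u1 - z.1*u2) * u1, μ * z.2.2)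
      map_add' := by intro x y; ext <;> simp <;> ring
      map_smul' := by intro c x; ext <;> simp <;> ring }
  let Λ := LinearMap.toContinuousLinearMap l
  have hΛ : ∀ z, Λ z = ((z.1*u1+z.2.1*u2) * u1 - μ * (z.2.1*u1 - z.1*u2) * u2, 
        (z.1*u1+z.2.1*u2) * u2 + μ * (z.2.1*u1 - z.1*u2) * u1, μ * z.2.2) := fun z => rfl
  have en : ∀ s, (p s * u1 - μ * q s * u2)^2 + (p s * u2 + μ * q s * u1)^2 = p s ^2 + (μ * q s)^2 := by
    intro s; linear_combination (p s ^2 + (μ * q s)^2) * hu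
  have ic' : IntervalIntegrable (fun s => Real.sqrt (p s ^2 + (μ * q s) ^2)) volume 0 1 := by
    refine (ip.abs.add (iq.const_mul μ).abs).mono_fun ?_ ?_
    · have mp := ip.def'.aestronglyMeasurable
      have mq := (iq.const_mul μ).def'.aestronglyMeasurable
      exact Real.continuous_sqrt.comp_aestronglyMeasurable ((mp.pow 2).add (mq.pow 2))
    · refine Filter.Eventually.of_forall fun s => ?_
      simp only [Real.norm_eq_abs, abs_of_nonneg (Real.sqrt_nonneg _)]
      refine le_trans ?_ (le_abs_self _)
      change _ ≤ |p s| + |μ * q s|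
      apply Real.sqrt_le_iff.2
      refine ⟨by positivity, ?_⟩
      rw [← sq_abs (p s), ← sq_abs (μ * q s)]
      nlinarith [abs_nonneg (p s), abs_nonneg (μ * q s), mul_nonneg (abs_nonneg (p s)) (abs_nonneg (μ * q s))]
  refine ⟨∫ s in (0:ℝ)..1, Real.sqrt (p s ^2 + (μ * q s) ^2), 
    ⟨fun s => Λ (γ s), fun s => p s * u1 - μ * q s * u2, fun s => p s * u2 + μ * q s * u1, ‖Λ‖₊ * K,
      Λ.lipschitz.comp g1, ?_, ?_, ?_, ?_, ?_⟩, ?_, ?_⟩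
  · simp [g2, HO, hΛ]
  · simp only [g3, hΛ]
    generalize Real.sqrt (w1^2+w2^2) = r at *
    ext
    · simp only [h1, h2]; linear_combination (r * u1) * hu
    · simp only [h1, h2]; linear_combination (r * u2) * hu
    · rfl
  · filter_upwards [g4] with s hs hs'
    have := (Λ.hasFDerivAt.comp_hasDerivAt s (hs hs'))
    refine this.congr_deriv ?_
    simp only [hΛ]
    ext
    · simp only; linear_combination (p s * u1 - μ * q s * u2) * hu
    · simp only; linear_combination (p s * u2 + μ * q s * u1) * hu
    · simp only
      generalize (γ s).1 = x
      generalize (γ s).2.1 = y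
      linear_combination (2 * μ * (x * (p s * u2 + q s * u1) - y * (p s * u1 - q s * u2))) * hu
  · simpa only [en] using ic'
  · simp only [en]
  · intro hμ
    rw [hc]
    apply intervalIntegral.integral_mono (by norm_num) ic' ic
    intro s
    apply Real.sqrt_le_sqrt
    have : μ^2 ≤ 1 := by rw [← sq_abs]; nlinarith [abs_nonneg μ]
    rw [mul_pow]
    nlinarith [sq_nonneg (q s)]
  · intro hμ
    have hP : Real.sqrt (w1^2+w2^2) ≤ ∫ s in (0:ℝ)..1, |p s| := by
      rw [← hr]
      exact (le_abs_self _).trans (intervalIntegral.abs_integral_le_integral_abs (by norm_num))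
    have : (∫ s in (0:ℝ)..1, Real.sqrt (p s ^2 + (μ * q s) ^2)) ≤ 
        ∫ s in (0:ℝ)..1, (Real.sqrt (p s^2+q s^2) + (μ^2-1) * (Real.sqrt (p s^2+q s^2) - |p s|)) := by
      apply intervalIntegral.integral_mono (by norm_num) ic' (ic.add ((ic.sub ip.abs).const_mul _))
      intro s
      exact stretch_pt (p s) (q s) μ hμ
    rw [intervalIntegral.integral_add ic ((ic.sub ip.abs).const_mul _),
      intervalIntegral.integral_const_mul, intervalIntegral.integral_sub ic ip.abs, ← hc] at this
    have hμ2 : 0 ≤ μ^2-1 := by nlinarith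
    nlinarith

lemma IsPath.square (t : ℝ) : IsPath HO (0, 0, t) (2 * Real.sqrt |t|) := by
  obtain ⟨σ, hσ, hσt⟩ : ∃ σ : ℝ, σ^2 = 1 ∧ -σ * |t| = t := by
    rcases le_total 0 t with h | h
    · exact ⟨-1, by norm_num, by rw [abs_of_nonneg h]; ring⟩
    · exact ⟨1, by norm_num, by rw [abs_of_nonpos h]; ring⟩
  have hs := Real.sq_sqrt (abs_nonneg t)
  have h0 := Real.sqrt_nonneg |t|
  generalize Real.sqrt |t| = k at *
  have q := (((IsPath.seg HO (k/2) 0).trans (IsPath.seg _ 0 (σ * (k/2)))).trans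
    (IsPath.seg _ (-(k/2)) 0)).trans (IsPath.seg _ 0 (-(σ * (k/2))))
  have e1 : Real.sqrt ((k/2)^2 + 0^2) = k/2 := by
    rw [show (k/2)^2 + 0^2 = (k/2)^2 by ring]; exact Real.sqrt_sq (by positivity)
  have e2 : Real.sqrt (0^2 + (σ * (k/2))^2) = k/2 := by
    rw [show 0^2 + (σ * (k/2))^2 = σ^2 * (k/2)^2 by ring, hσ, one_mul]; exact Real.sqrt_sq (by positivity)
  rw [neg_sq, neg_sq, e1, e2] at q
  convert q using 1
  · ext
    · simp [Hmul, HO]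
    · simp [Hmul, HO]
    · simp [Hmul, HO]
      rw [← hσt, ← hs]; ring
  · ring

lemma IsPath.crude (w1 w2 t : ℝ) :
    IsPath HO (w1, w2, t) (Real.sqrt (w1^2+w2^2) + 2 * Real.sqrt |t|) := by
  have h1 := IsPath.seg HO w1 w2
  have h2 := (IsPath.square t).left (w1, w2, 0)
  have e1 : Hmul HO (w1, w2, 0) = (w1, w2, 0) := by ext <;> simp [Hmul, HO]
  have e2 : Hmul (w1, w2, 0) HO = (w1, w2, 0) := by ext <;> simp [Hmul, HO]
  have e3 : Hmul (w1, w2, 0) (0, 0, t) = (w1, w2, t) := by ext <;> simp [Hmul]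
  rw [e1] at h1
  rw [e2, e3] at h2
  exact h1.trans h2

lemma path_nonempty (w : H) : {L | IsPath HO w L}.Nonempty := 
  ⟨_, IsPath.crude w.1 w.2.1 w.2.2⟩

lemma dH_crude (w1 w2 t : ℝ) : dH HO (w1, w2, t) ≤ Real.sqrt (w1^2+w2^2) + 2 * Real.sqrt |t| :=
  dH_le (IsPath.crude w1 w2 t)

lemma dH_tri (w1 w2 t : ℝ) (hr : 0 < Real.sqrt (w1^2+w2^2)) : dH HO (w1, w2, t) ≤ 
    Real.sqrt (w1^2+w2^2) + t^2 / (2 * Real.sqrt (w1^2+w2^2)^3) := by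
  have hs := Real.sq_sqrt (show 0 ≤ w1^2+w2^2 by positivity)
  set r := Real.sqrt (w1^2+w2^2) with hrdef
  clear_value r
  obtain ⟨k, hk⟩ : ∃ k, k = t / (2 * r^2) := ⟨_, rfl⟩
  have ht : t = 2 * k * r^2 := by rw [hk]; field_simp
  have q := (IsPath.seg HO (w1/2 - k*w2) (w2/2 + k*w1)).trans
    (IsPath.seg _ (w1/2 + k*w2) (w2/2 - k*w1))
  have e : Hmul (Hmul HO (w1/2 - k*w2, w2/2 + k*w1, 0)) (w1/2 + k*w2, w2/2 - k*w1, 0) = (w1, w2, t) := by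
    ext
    · simp [Hmul, HO]
    · simp [Hmul, HO]
    · simp [Hmul, HO]
      rw [ht, hs]; ring
  rw [e] at q
  refine (dH_le q).trans ?_
  have b : Real.sqrt (r^2/4 + k^2*r^2) ≤ r/2 + k^2 * r := by
    apply Real.sqrt_le_iff.2
    refine ⟨by positivity, ?_⟩
    nlinarith [sq_nonneg (k^2*r)]
  rw [show (w1/2 - k*w2)^2 + (w2/2 + k*w1)^2 = r^2/4 + k^2*r^2 by rw [hs]; ring,
    show (w1/2 + k*w2)^2 + (w2/2 - k*w1)^2 = r^2/4 + k^2*r^2 by rw [hs]; ring]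
  have : t^2 / (2 * r^3) = 2 * (k^2 * r) := by
    rw [ht]; field_simp; try ring
  rw [this]; linarith

lemma dH_dido (w1 w2 t : ℝ) : Real.sqrt (w1^2+w2^2) ≤ dH HO (w1, w2, t) ∧
    t^2 ≤ 16 * dH HO (w1, w2, t)^2 * (dH HO (w1, w2, t)^2 - (w1^2+w2^2)) := by
  have hm := csInf_mem_closure (path_nonempty (w1, w2, t)) (bddBelow_path _ _)
  rw [← dH_eq] at hm
  have hcl : IsClosed {L : ℝ | Real.sqrt (w1^2+w2^2) ≤ L ∧ t^2 ≤ 16 * L^2 * (L^2 - (w1^2+w2^2))} := by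
    have c1 : IsClosed {L : ℝ | Real.sqrt (w1^2+w2^2) ≤ L} := isClosed_le (by fun_prop) (by fun_prop)
    have c2 : IsClosed {L : ℝ | t^2 ≤ 16 * L^2 * (L^2 - (w1^2+w2^2))} :=
      isClosed_le (by fun_prop) (by fun_prop)
    exact c1.inter c2
  exact closure_minimal (fun L hL => IsPath.dido hL) hcl hm

lemma dH_stretch (w1 w2 t μ : ℝ) (h : 1 ≤ μ) : dH HO (w1, w2, μ * t) ≤ 
    dH HO (w1, w2, t) + (μ^2-1) * (dH HO (w1, w2, t) - Real.sqrt (w1^2+w2^2)) := by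
  have hm := csInf_mem_closure (path_nonempty (w1, w2, t)) (bddBelow_path _ _)
  rw [← dH_eq] at hm
  have hcl : IsClosed {L : ℝ | dH HO (w1, w2, μ * t) ≤ L + (μ^2-1) * (L - Real.sqrt (w1^2+w2^2))} := 
    isClosed_le (by fun_prop) (by fun_prop)
  refine closure_minimal (fun L hL => ?_) hcl hm
  obtain ⟨L', h1, -, h2⟩ := IsPath.stretch hL μ
  exact (dH_le h1).trans (h2 h)

lemma dH_shrink (w1 w2 t μ : ℝ) (h : |μ| ≤ 1) : dH HO (w1, w2, μ * t) ≤ dH HO (w1, w2, t) := by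
  rw [dH_eq HO (w1, w2, t)]
  apply le_csInf (path_nonempty _)
  intro L hL
  obtain ⟨L', h1, h2, -⟩ := IsPath.stretch hL μ
  exact (dH_le h1).trans (h2 h)

lemma dH_left (P Q : H) : dH P Q = dH HO (Hmul (Hinv P) Q) := by
  rw [dH_eq, dH_eq]
  congr 1
  ext L
  constructor
  · intro h
    have := IsPath.left h (Hinv P)
    have e : Hmul (Hinv P) P = HO := by 
      ext <;> simp [Hmul, Hinv, HO] <;> ring
    rwa [e] at this
  · intro h
    have := IsPath.left h P
    have e : Hmul P HO = P := by ext <;> simp [Hmul, HO]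
    have e' : Hmul P (Hmul (Hinv P) Q) = Q := by 
      ext <;> simp [Hmul, Hinv] <;> ring
    rwa [e, e'] at this

lemma dH_cat (z1 z2 : ℝ) (W : H) : 
    dH HO (Hmul (z1, z2, 0) W) ≤ Real.sqrt (z1^2+z2^2) + dH HO W := by
  have : dH HO (Hmul (z1, z2, 0) W) - Real.sqrt (z1^2+z2^2) ≤ dH HO W := by
    rw [dH_eq HO W]
    apply le_csInf (path_nonempty _)
    intro L hL
    have h1 := IsPath.seg HO z1 z2
    have h2 := IsPath.left hL (z1, z2, 0)
    have e1 : Hmul HO (z1, z2, 0) = (z1, z2, 0) := by ext <;> simp [Hmul, HO]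
    have e2 : Hmul (z1, z2, 0) HO = (z1, z2, 0) := by ext <;> simp [Hmul, HO]
    rw [e1] at h1
    rw [e2] at h2
    linarith [dH_le (h1.trans h2)]
  linarith

lemma dH_shift (w1 w2 t t1 D ε l : ℝ) (hl : 0 < l) (hε : 0 ≤ ε) (hε1 : ε ≤ 1/10) (hεD : ε ≤ D)
    (hD : 0 < D) (hD1 : D ≤ 1)
    (h1 : (1 - ε) * (15999999 * l) ≤ dH HO (w1, w2, t))
    (h2 : dH HO (w1, w2, t) ≤ (1 + ε) * (15999999 * l))
    (h3 : (1 - D) * (15999999 * l) ≤ Real.sqrt (w1^2+w2^2))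
    (ht1 : t1^2 ≤ 400 * D * l^4) :
    dH HO (w1, w2, t + t1) ≤ dH HO (w1, w2, t) + D * l / 4 := by
  have hd1 := (dH_dido w1 w2 t).1
  have hcr := dH_crude w1 w2 t
  obtain ⟨σ, hσ, hσD⟩ : ∃ σ : ℝ, 0 < σ ∧ σ^2 = D := 
    ⟨Real.sqrt D, Real.sqrt_pos.2 hD, Real.sq_sqrt hD.le⟩
  have hσ1 : σ ≤ 1 := by nlinarith
  have ht1' : |t1| ≤ 20 * σ * l^2 := by
    apply abs_le_of_sq_le_sq _ (by positivity)
    rw [← hσD] at ht1; nlinarith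
  have hDl : 0 < D * l := by positivity
  have hεl : ε * l ≤ D * l := by nlinarith
  have hσl : 0 < σ * l^2 := by positivity
  rcases le_total (8000000000 * σ * l^2) |t| with hA | hB
  · have htpos : 0 < |t| := by nlinarith
    have ht0 : t ≠ 0 := abs_pos.1 htpos
    obtain ⟨ρ, hρ⟩ : ∃ ρ, ρ = t1 / t := ⟨_, rfl⟩
    have e : t + t1 = (1 + ρ) * t := by rw [hρ]; field_simp
    have hρ' : |ρ| ≤ 1/400000000 := by
      rw [hρ, abs_div, div_le_iff₀ htpos]; nlinarith
    have hρ2 := abs_le.1 hρ'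
    rw [e]
    rcases le_total ρ 0 with h | h
    · have := dH_shrink w1 w2 t (1+ρ) (by rw [abs_le]; constructor <;> linarith)
      linarith
    · have := dH_stretch w1 w2 t (1+ρ) (by linarith)
      refine this.trans ?_
      have k1 : (1+ρ)^2 - 1 ≤ 3/400000000 := by nlinarith
      have k0 : 0 ≤ (1+ρ)^2 - 1 := by nlinarith
      have k2 : dH HO (w1, w2, t) - Real.sqrt (w1^2+w2^2) ≤ 32000000 * (D * l) := by nlinarith
      have := mul_le_mul k1 k2 (by linarith) (by norm_num)
      linarith
  · have hB' : |t + t1| ≤ 8100000000 * σ * l^2 := by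
      have := abs_add_le t t1
      nlinarith
    have hs : Real.sqrt |t| ≤ 90000 * l := by
      apply Real.sqrt_le_iff.2
      refine ⟨by positivity, ?_⟩
      have : σ * l^2 ≤ l^2 := by nlinarith [sq_nonneg l]
      nlinarith
    have hr : 14000000 * l ≤ Real.sqrt (w1^2+w2^2) := by nlinarith
    have hrp : 0 < Real.sqrt (w1^2+w2^2) := by nlinarith
    refine (dH_tri w1 w2 (t+t1) hrp).trans ?_
    have : (t+t1)^2 / (2 * Real.sqrt (w1^2+w2^2)^3) ≤ D * l / 4 := by
      rw [div_le_iff₀ (by positivity)]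
      have a1 : (t+t1)^2 ≤ (8100000000 * σ * l^2)^2 := by
        rw [← sq_abs]; exact pow_le_pow_left₀ (abs_nonneg _) hB' 2
      have a2 : (14000000 * l)^3 ≤ Real.sqrt (w1^2+w2^2)^3 := pow_le_pow_left₀ (by positivity) hr 3
      have a3 : (8100000000 * σ * l^2)^2 = 65610000000000000000 * (D * l^4) := by rw [← hσD]; ring
      have a4 := mul_le_mul_of_nonneg_left a2 hDl.le
      have a5 : D * l * (14000000 * l)^3 = 2744000000000000000000 * (D * l^4) := by ring
      have a6 : 0 < D * l^4 := by positivity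
      rw [a3] at a1
      rw [a5] at a4
      linarith
    linarith

lemma one_sub_le_inv {ε : ℝ} (hε : 0 ≤ ε) : 1 - ε ≤ (1 + ε)⁻¹ := by
  rw [← one_div, le_div_iff₀ (by linarith)]
  nlinarith

/-- planar distance -/
def pd (P Q : H) : ℝ := Real.sqrt ((Q.1 - P.1)^2 + (Q.2.1 - P.2.1)^2)

/-- vertical component of `P⁻¹ Q` -/
def vt (P Q : H) : ℝ := (Hmul (Hinv P) Q).2.2

lemma Hmul_inv_eq (P Q : H) : Hmul (Hinv P) Q = (Q.1 - P.1, Q.2.1 - P.2.1, vt P Q) := by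
  ext <;> simp [Hmul, Hinv, vt] <;> ring

lemma quasi_bounds {ε : ℝ} {γ : ℝ → H} (hε : 0 ≤ ε) (hγ : IsQuasiGeodesic ε γ) (s s' : ℝ) (h : s < s') :
    (1 - ε) * (s' - s) ≤ dH HO (Hmul (Hinv (γ s)) (γ s')) ∧
    dH HO (Hmul (Hinv (γ s)) (γ s')) ≤ (1 + ε) * (s' - s) := by
  have := hγ s s'
  rw [dH_left, abs_sub_comm, abs_of_pos (sub_pos.2 h)] at this
  refine ⟨le_trans ?_ this.1, this.2⟩
  exact mul_le_mul_of_nonneg_right (one_sub_le_inv hε) (sub_pos.2 h).le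

lemma quasi_vt {ε D : ℝ} {γ : ℝ → H} (hε : 0 ≤ ε) (hε1 : ε ≤ 1/10) (hεD : ε ≤ D) (hD1 : D ≤ 1)
    (hγ : IsQuasiGeodesic ε γ) (s s' : ℝ) (h : s < s')
    (hp : (1 - D) * (s' - s) ≤ pd (γ s) (γ s')) :
    vt (γ s) (γ s') ^2 ≤ 400 * D * (s' - s)^4 := by
  have hb := (quasi_bounds hε hγ s s' h).2
  rw [Hmul_inv_eq] at hb
  obtain ⟨k1, k2⟩ := dH_dido ((γ s').1 - (γ s).1) ((γ s').2.1 - (γ s).2.1) (vt (γ s) (γ s'))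
  have hsq := Real.sq_sqrt (show 0 ≤ ((γ s').1 - (γ s).1)^2 + ((γ s').2.1 - (γ s).2.1)^2 by positivity)
  rw [← hsq] at k2
  unfold pd at hp
  set r := Real.sqrt (((γ s').1 - (γ s).1)^2 + ((γ s').2.1 - (γ s).2.1)^2)
  have hr0 : 0 ≤ r := Real.sqrt_nonneg _
  generalize dH HO ((γ s').1 - (γ s).1, (γ s').2.1 - (γ s).2.1, vt (γ s) (γ s')) = d at *
  clear_value r
  obtain ⟨l, hl⟩ : ∃ l, l = s' - s := ⟨_, rfl⟩
  rw [← hl] at hp hb ⊢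
  have hl0 : 0 < l := by rw [hl]; linarith
  have hd0 : 0 ≤ d := hr0.trans k1
  have a1 : d^2 ≤ ((1+ε)*l)^2 := pow_le_pow_left₀ hd0 hb 2
  have a2 : ((1-D)*l)^2 ≤ r^2 := pow_le_pow_left₀ (mul_nonneg (by linarith) hl0.le) hp 2
  have a3 : d^2 - r^2 ≤ 5 * D * l^2 := by
    have : (1+ε)^2 - (1-D)^2 ≤ 5 * D := by nlinarith
    have := mul_le_mul_of_nonneg_right this (sq_nonneg l)
    nlinarith
  have a4 : d^2 ≤ 2 * l^2 := by
    have : (1+ε)^2 ≤ 2 := by nlinarith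
    have := mul_le_mul_of_nonneg_right this (sq_nonneg l)
    nlinarith
  have a5 : 0 ≤ d^2 - r^2 := by nlinarith
  have a6 := mul_le_mul a4 a3 a5 (by positivity)
  have a7 : 0 ≤ D * l^4 := mul_nonneg (hε.trans hεD) (by positivity)
  nlinarith

lemma quasi_deficit {ε : ℝ} {γ : ℝ → H} (hε : 0 ≤ ε) (hε1 : ε ≤ 1/10) (hγ : IsQuasiGeodesic ε γ)
    (s s' : ℝ) (h : s < s') : (1 - 128000000 * ε) * (s' - s) ≤ pd (γ s) (γ s') := by
  set S : Set ℝ := {δ | ∃ s s' : ℝ, s < s' ∧ δ = 1 - pd (γ s) (γ s') / (s' - s)} with hS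
  have hle1 : ∀ δ ∈ S, δ ≤ 1 := by
    rintro δ ⟨s, s', hs, rfl⟩
    have : 0 ≤ pd (γ s) (γ s') / (s' - s) := div_nonneg (Real.sqrt_nonneg _) (by linarith)
    linarith
  have hbdd : BddAbove S := ⟨1, hle1⟩
  have hmem : (1 - pd (γ s) (γ s') / (s' - s)) ∈ S := ⟨s, s', h, rfl⟩
  have hne : S.Nonempty := ⟨_, hmem⟩
  set D := sSup S with hDdef
  have hD1 : D ≤ 1 := csSup_le hne hle1
  have hall : ∀ s s' : ℝ, s < s' → (1 - D) * (s' - s) ≤ pd (γ s) (γ s') := by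
    intro s s' hs
    have : 1 - pd (γ s) (γ s') / (s' - s) ≤ D := le_csSup hbdd ⟨s, s', hs, rfl⟩
    rw [← le_div_iff₀ (by linarith)]
    linarith
  suffices hD : D ≤ 128000000 * ε by
    refine le_trans ?_ (hall s s' h)
    exact mul_le_mul_of_nonneg_right (by linarith) (by linarith)
  by_contra hcon
  push Not at hcon
  have hD0 : 0 < D := by linarith
  have hεD : ε ≤ D := by linarith
  obtain ⟨δ, ⟨s1, s2, h12, rfl⟩, hδ⟩ := exists_lt_of_lt_csSup hne (show D/2 < D by linarith)
  obtain ⟨l, hl⟩ : ∃ l, l = s2 - s1 := ⟨_, rfl⟩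
  have hl0 : 0 < l := by rw [hl]; linarith
  obtain ⟨s3, hs3⟩ : ∃ s3, s3 = s2 + 15999999 * l := ⟨_, rfl⟩
  have h23 : s2 < s3 := by rw [hs3]; linarith
  have h13 : s1 < s3 := h12.trans h23
  have e23 : s3 - s2 = 15999999 * l := by rw [hs3]; ring
  have e13 : s3 - s1 = 16000000 * l := by rw [hs3, hl]; ring
  have t1b := quasi_vt hε hε1 hεD hD1 hγ s1 s2 h12 (hall s1 s2 h12)
  have b23 := quasi_bounds hε hγ s2 s3 h23
  have b13 := (quasi_bounds hε hγ s1 s3 h13).1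
  have p23 := hall s2 s3 h23
  have p12 : pd (γ s1) (γ s2) ≤ (1 - D/2) * l := by
    rw [← hl] at hδ
    rw [← div_le_iff₀ hl0]; linarith
  rw [e23] at b23 p23
  rw [e13] at b13
  rw [← hl] at t1b
  rw [Hmul_inv_eq (γ s2)] at b23
  have sh := dH_shift _ _ _ _ D ε l hl0 hε hε1 hεD hD0 hD1 b23.1 b23.2 p23 t1b
  have cat := dH_cat ((γ s2).1 - (γ s1).1) ((γ s2).2.1 - (γ s1).2.1) 
    ((γ s3).1 - (γ s2).1, (γ s3).2.1 - (γ s2).2.1, vt (γ s2) (γ s3) + vt (γ s1) (γ s2))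
  have e : Hmul ((γ s2).1 - (γ s1).1, (γ s2).2.1 - (γ s1).2.1, 0)
    ((γ s3).1 - (γ s2).1, (γ s3).2.1 - (γ s2).2.1, vt (γ s2) (γ s3) + vt (γ s1) (γ s2)) = 
      Hmul (Hinv (γ s1)) (γ s3) := by
    ext <;> simp [Hmul, Hinv, vt] <;> ring
  rw [e] at cat
  change _ ≤ pd (γ s1) (γ s2) + _ at cat
  have fin : (1 - ε) * (16000000 * l) ≤ (1 - D/2) * l + ((1+ε) * (15999999 * l) + D * l / 4) := by
    linarith [b23.2]
  have : (128000000 * ε) * l < D * l := mul_lt_mul_of_pos_right hcon hl0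
  have : 0 ≤ ε * l := by positivity
  nlinarith

/-- Proposition on quasigeodesics through the origin.
There are absolute constants `ε₀ > 0`, `C > 0` such that for every
`(1+ε)`-quasigeodesic `γ = (ζ; τ)` with `ε < ε₀` and `γ(0) = O`:
`1 − C√ε ≤ |ζ(s)|/|s| ≤ 1 + Cε` for `s ≠ 0`, and `|τ(s)| ≤ C ε^{1/4} s²`. -/
theorem statement1 :
    ∃ ε₀ > (0:ℝ), ∃ C > (0:ℝ),
      ∀ ε : ℝ, 0 ≤ ε → ε < ε₀ →
      ∀ γ : ℝ → H, IsQuasiGeodesic ε γ → γ 0 = HO →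
        (∀ s : ℝ, s ≠ 0 →
          1 - C * Real.sqrt ε ≤ Real.sqrt ((γ s).1 ^ 2 + (γ s).2.1 ^ 2) / |s| ∧
          Real.sqrt ((γ s).1 ^ 2 + (γ s).2.1 ^ 2) / |s| ≤ 1 + C * ε) ∧
        (∀ s : ℝ, |(γ s).2.2| ≤ C * ε ^ ((1:ℝ)/4) * s ^ 2) := by
  refine ⟨1/1000000000, by norm_num, 1000000000, by norm_num, ?_⟩
  intro ε hε hε0 γ hγ h0
  have hε1 : ε ≤ 1/10 := by linarith
  have main : ∀ s : ℝ, s ≠ 0 → 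
      (1 - 128000000 * ε) * |s| ≤ Real.sqrt ((γ s).1 ^ 2 + (γ s).2.1 ^ 2) ∧
      Real.sqrt ((γ s).1 ^ 2 + (γ s).2.1 ^ 2) ≤ (1 + ε) * |s| ∧
      (γ s).2.2^2 ≤ 400 * (128000001 * ε) * s^4 := by
    have aux : ∀ s s' : ℝ, s < s' → (1 - 128000000 * ε) * (s' - s) ≤ pd (γ s) (γ s') ∧
        pd (γ s) (γ s') ≤ (1 + ε) * (s' - s) ∧ 
        vt (γ s) (γ s') ^ 2 ≤ 400 * (128000001 * ε) * (s' - s)^4 := by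
      intro s s' h
      have k1 := quasi_deficit hε hε1 hγ s s' h
      refine ⟨k1, ?_, ?_⟩
      · have := (quasi_bounds hε hγ s s' h).2
        rw [Hmul_inv_eq] at this
        exact (dH_dido _ _ _).1.trans this
      · refine quasi_vt hε hε1 (by linarith) (by linarith) hγ s s' h (le_trans ?_ k1)
        exact mul_le_mul_of_nonneg_right (by linarith) (by linarith)
    intro s hs
    rcases lt_or_gt_of_ne hs with h | h
    · have := aux s 0 h
      rw [h0] at this
      simp only [pd, vt, Hmul, Hinv, HO] at this
      rw [abs_of_neg h]
      ring_nf at this ⊢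
      exact this
    · have := aux 0 s h
      rw [h0] at this
      simp only [pd, vt, Hmul, Hinv, HO] at this
      rw [abs_of_pos h]
      ring_nf at this ⊢
      exact this
  refine ⟨?_, ?_⟩
  · intro s hs
    obtain ⟨m1, m2, -⟩ := main s hs
    have hp : 0 < |s| := abs_pos.2 hs
    rw [le_div_iff₀ hp, div_le_iff₀ hp]
    have hq := Real.sq_sqrt hε
    have hq0 := Real.sqrt_nonneg ε
    have hq1 : Real.sqrt ε ≤ 1 := by rw [Real.sqrt_le_one]; linarith
    have hq2 : ε ≤ Real.sqrt ε := by nlinarith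
    constructor
    · refine le_trans (mul_le_mul_of_nonneg_right ?_ hp.le) m1
      linarith
    · refine m2.trans (mul_le_mul_of_nonneg_right ?_ hp.le)
      linarith
  · intro s
    by_cases hs : s = 0
    · rw [hs, h0]; simp [HO]
    obtain ⟨-, -, m3⟩ := main s hs
    have he0 : 0 ≤ ε ^ ((1:ℝ)/4) := Real.rpow_nonneg hε _
    have he1 : ε ^ ((1:ℝ)/4) ≤ 1 := Real.rpow_le_one hε (by linarith) (by norm_num)
    have he4 : (ε ^ ((1:ℝ)/4))^4 = ε := by
      rw [← Real.rpow_natCast, ← Real.rpow_mul hε]; norm_num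
    generalize ε ^ ((1:ℝ)/4) = e at *
    apply abs_le_of_sq_le_sq _ (by positivity)
    refine m3.trans ?_
    have h1 : ε ≤ e^2 := by rw [← he4]; exact pow_le_pow_of_le_one he0 he1 (by norm_num)
    have h2 : 0 ≤ s^4 := by positivity
    have h3 := mul_le_mul_of_nonneg_right h1 h2
    have h4 : 0 ≤ e^2 * s^4 := by positivity
    have h5 : (1000000000 * e * s^2)^2 = 1000000000000000000 * (e^2 * s^4) := by ring
    rw [h5]
    nlinarith
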